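/- If a class of languages 𝓛 contains all linear context-free languages and is closed under circular permutation, left derivative, and substitution, then 𝓛 is closed under iterated m-bounded k-hairpin incompletion HI*_{m,k} for all m, k ≥ 1. -/

import Mathlib

open scoped Classical

namespace Hairpin

variable {V : Type}

/-- Reversed complement of a word under the involution `bar`. -/
def rc (bar : V → V) (w : List V) : List V := (w.map bar).reverse

/-- `w` admits a right hairpin decomposition `w = δγαβᾱ^R` with `|α| = k`, `|γ| ≤ m`. -/
def hasRightDecomp (bar : V → V) (m k : ℕ) (w : List V) : Prop :=
  ∃ δ γ α β : List V, w = δ ++ γ ++ α ++ β ++ rc bar α ∧ α.length = k ∧ γ.length ≤ m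

def hasLeftDecomp (bar : V → V) (m k : ℕ) (w : List V) : Prop :=
  ∃ α β γ δ : List V, w = α ++ β ++ rc bar α ++ γ ++ δ ∧ α.length = k ∧ γ.length ≤ m

/-- m-bounded right k-hairpin incompletion. -/
noncomputable def rHI (bar : V → V) (m k : ℕ) (w : List V) : Set (List V) :=
  if hasRightDecomp bar m k w then
    { v | ∃ δ γ α β : List V, w = δ ++ γ ++ α ++ β ++ rc bar α ∧ α.length = k ∧
          γ.length ≤ m ∧ v = w ++ rc bar γ }
  else {w}

/-- m-bounded left k-hairpin incompletion. -/
noncomputable def lHI (bar : V → V) (m k : ℕ) (w : List V) : Set (List V) :=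
  if hasLeftDecomp bar m k w then
    { v | ∃ α β γ δ : List V, w = α ++ β ++ rc bar α ++ γ ++ δ ∧ α.length = k ∧
          γ.length ≤ m ∧ v = rc bar γ ++ w }
  else {w}

/-- m-bounded k-hairpin incompletion. -/
noncomputable def HI (bar : V → V) (m k : ℕ) (w : List V) : Set (List V) :=
  rHI bar m k w ∪ lHI bar m k w

noncomputable def rHIn (bar : V → V) (m k : ℕ) (w : List V) : ℕ → Set (List V)
  | 0 => {w}
  | n + 1 => ⋃ v ∈ rHIn bar m k w n, rHI bar m k v

noncomputable def rHIstar (bar : V → V) (m k : ℕ) (w : List V) : Set (List V) :=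
  ⋃ n, rHIn bar m k w n

noncomputable def HIn (bar : V → V) (m k : ℕ) (w : List V) : ℕ → Set (List V)
  | 0 => {w}
  | n + 1 => ⋃ v ∈ HIn bar m k w n, HI bar m k v

noncomputable def HIstar (bar : V → V) (m k : ℕ) (w : List V) : Set (List V) :=
  ⋃ n, HIn bar m k w n

noncomputable def rHIstarL (bar : V → V) (m k : ℕ) (L : Set (List V)) : Set (List V) :=
  ⋃ w ∈ L, rHIstar bar m k w

noncomputable def HIL (bar : V → V) (m k : ℕ) (L : Set (List V)) : Set (List V) :=
  ⋃ w ∈ L, HI bar m k w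

noncomputable def HIstarL (bar : V → V) (m k : ℕ) (L : Set (List V)) : Set (List V) :=
  ⋃ w ∈ L, HIstar bar m k w

/-- The set `C_{m,k}(w)`. -/
def Cmk (bar : V → V) (m k : ℕ) (w : List V) : Set (List V × List V) :=
  { p | ∃ x y w₁ w₂ z : List V,
      x.length ≤ m ∧ y.length = k ∧ w = w₁ ++ (x ++ y) ++ w₂ ∧
      z.length ≤ k ∧ z <:+ w₂ ∧ z <+: rc bar y ∧ p = (x ++ y, z) }

/-- The suffix component of `D_{m,k}(w)`: all suffixes of `w` of length `i+k-1`, `0 ≤ i ≤ m`. -/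
def DmkSuf (m k : ℕ) (w : List V) : Set (List V) :=
  { s | ∃ i ≤ m, s.length = i + k - 1 ∧ s <:+ w }

noncomputable def Dmk (bar : V → V) (m k : ℕ) (w : List V) :
    Set (List V × List V) × Set (List V) :=
  (Cmk bar m k w, DmkSuf m k w)

/-- The set `C'_{m,k}(w)`. -/
def Cmk' (bar : V → V) (m k : ℕ) (w : List V) : Set (List V × List V) :=
  { p | ∃ x y w₁ w₂ z : List V,
      x.length ≤ m ∧ y.length = k ∧ w = w₁ ++ (y ++ x) ++ w₂ ∧
      z.length ≤ k ∧ z <+: w₁ ∧ z <:+ rc bar y ∧ p = (z, y ++ x) }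

/-- The prefix component of `D'_{m,k}(w)`. -/
def DmkPref (m k : ℕ) (w : List V) : Set (List V) :=
  { s | ∃ i ≤ m, s.length = i + k - 1 ∧ s <+: w }

noncomputable def Dmk' (bar : V → V) (m k : ℕ) (w : List V) :
    Set (List V × List V) × Set (List V) :=
  (Cmk' bar m k w, DmkPref m k w)

noncomputable def Emk (bar : V → V) (m k : ℕ) (w : List V) :=
  (Dmk bar m k w, Dmk' bar m k w)


/-- View a set of words as a `Language`. -/
def lang {V : Type} (L : Set (List V)) : Language V := L


/-- Circular permutation of a language. -/
def cp (L : Set (List V)) : Set (List V) := { w | ∃ u v : List V, u ++ v ∈ L ∧ w = v ++ u }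

/-- Left derivative of a language by a word. -/
def leftDeriv (w : List V) (L : Set (List V)) : Set (List V) := { x | w ++ x ∈ L }

/-- Substitution applied to a word. -/
def substW {α β : Type} (f : α → Set (List β)) : List α → Set (List β)
  | [] => {[]}
  | a :: u => Set.image2 (· ++ ·) (f a) (substW f u)

/-- Substitution applied to a language. -/
def substL {α β : Type} (f : α → Set (List β)) (L : Set (List α)) : Set (List β) :=
  ⋃ w ∈ L, substW f w

/-- A language is linear if it is generated by a context-free grammar each of whose rules
has at most one nonterminal on its right-hand side. -/
def IsLinearLang {T : Type} (L : Set (List T)) : Prop :=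
  ∃ g : ContextFreeGrammar.{0} T,
    (∀ r ∈ g.rules,
      (r.output.countP fun s => match s with
        | Symbol.nonterminal _ => true
        | Symbol.terminal _ => false) ≤ 1) ∧
    g.language = lang L

section helpers

inductive Gen {N T : Type} (R : N → List T → N → List T → Prop) (F : N → List T → Prop) :
    N → List T → Prop
  | base {A : N} {w : List T} : F A w → Gen R F A w
  | step {A B : N} {u v w : List T} : R A u B v → Gen R F B w → Gen R F A (u ++ w ++ v)

theorem split_unique {N T : Type} {u v : List T} {p q : List (Symbol T N)} {B C : N}
    (h : u.map Symbol.terminal ++ [Symbol.nonterminal B] ++ v.map Symbol.terminal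
      = p ++ [Symbol.nonterminal C] ++ q) :
    p = u.map Symbol.terminal ∧ C = B ∧ q = v.map Symbol.terminal := by
  induction u generalizing p with
  | nil =>
    cases p with
    | nil => simp at h; exact ⟨rfl, h.1.symm, h.2.symm⟩
    | cons a p =>
      simp at h
      have : (Symbol.nonterminal C : Symbol T N) ∈ v.map Symbol.terminal := by
        rw [h.2]; simp
      simp at this
  | cons a u ih =>
    cases p with
    | nil => simp at h
    | cons b p =>
      simp only [List.map_cons, List.cons_append, List.cons.injEq] at h
      obtain ⟨h1, h2, h3⟩ := ih h.2
      exact ⟨by rw [h1, ← h.1]; rfl, h2, h3⟩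

theorem countP_term {N T : Type} (p : Symbol T N → Bool)
    (hp : ∀ t, p (Symbol.terminal t) = false) (u : List T) :
    (u.map Symbol.terminal).countP p ≤ 1 := by
  have : (u.map Symbol.terminal).countP p = 0 := by
    rw [List.countP_eq_zero]; simp [hp]
  omega

theorem countP_lin {N T : Type} (p : Symbol T N → Bool)
    (hp : ∀ t, p (Symbol.terminal t) = false) (u : List T) (B : N) (v : List T) :
    (u.map Symbol.terminal ++ [Symbol.nonterminal B] ++ v.map Symbol.terminal).countP p ≤ 1 := by
  have h : ∀ u : List T, (u.map Symbol.terminal).countP p = 0 := by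
    intro u; rw [List.countP_eq_zero]; simp [hp]
  have h2 := List.countP_le_length (p := p) (l := [Symbol.nonterminal B])
  rw [List.countP_append, List.countP_append, h, h]
  simpa using h2

theorem isLinear_gen {N T : Type} (R : N → List T → N → List T → Prop) (F : N → List T → Prop)
    (hR : {p : N × List T × N × List T | R p.1 p.2.1 p.2.2.1 p.2.2.2}.Finite)
    (hF : {p : N × List T | F p.1 p.2}.Finite) (A0 : N) :
    IsLinearLang {w | Gen R F A0 w} := by
  let g : ContextFreeGrammar.{0} T :=
    { NT := N
      initial := A0
      rules := hR.toFinset.image (fun p => (⟨p.1, p.2.1.map Symbol.terminal ++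
          [Symbol.nonterminal p.2.2.1] ++ p.2.2.2.map Symbol.terminal⟩ : ContextFreeRule T N)) ∪
        hF.toFinset.image (fun p => (⟨p.1, p.2.map Symbol.terminal⟩ : ContextFreeRule T N)) }
  have hr : ∀ r : ContextFreeRule T N, r ∈ g.rules ↔
      (∃ A u B v, R A u B v ∧ r = ⟨A, u.map Symbol.terminal ++
          [Symbol.nonterminal B] ++ v.map Symbol.terminal⟩) ∨
      (∃ A w, F A w ∧ r = ⟨A, w.map Symbol.terminal⟩) := by
    intro r
    simp only [g, Finset.mem_union, Finset.mem_image, Set.Finite.mem_toFinset, Set.mem_ofPred_eq]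
    constructor
    · rintro (⟨⟨A, u, B, v⟩, h, rfl⟩ | ⟨⟨A, w⟩, h, rfl⟩)
      · exact Or.inl ⟨A, u, B, v, h, rfl⟩
      · exact Or.inr ⟨A, w, h, rfl⟩
    · rintro (⟨A, u, B, v, h, rfl⟩ | ⟨A, w, h, rfl⟩)
      · exact Or.inl ⟨⟨A, u, B, v⟩, h, rfl⟩
      · exact Or.inr ⟨⟨A, w⟩, h, rfl⟩
  refine ⟨g, ?_, ?_⟩
  · intro r hrm
    rcases (hr r).1 hrm with ⟨A, u, B, v, h, rfl⟩ | ⟨A, w, h, rfl⟩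
    · exact countP_lin _ (fun _ => rfl) u B v
    · exact countP_term _ (fun _ => rfl) w
  · ext w
    change g.Derives [Symbol.nonterminal A0] (w.map Symbol.terminal) ↔ Gen R F A0 w
    constructor
    · intro h
      have key : ∀ s : List (Symbol T N), g.Derives [Symbol.nonterminal A0] s →
          (∃ u B v, s = u.map Symbol.terminal ++ [Symbol.nonterminal B] ++ v.map Symbol.terminal ∧
            ∀ w, Gen R F B w → Gen R F A0 (u ++ w ++ v)) ∨
          (∃ w, s = w.map Symbol.terminal ∧ Gen R F A0 w) := by
        intro s hs
        induction hs with
        | refl => exact Or.inl ⟨[], A0, [], by simp, by simp⟩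
        | tail _ hp ih =>
          obtain ⟨r, hrm, hrw⟩ := hp
          rw [ContextFreeRule.rewrites_iff] at hrw
          obtain ⟨p, q, h1, h2⟩ := hrw
          rcases ih with ⟨u, B, v, rfl, hg⟩ | ⟨w, rfl, hg⟩
          · obtain ⟨rfl, hB, rfl⟩ := split_unique h1
            rcases (hr r).1 hrm with ⟨A, u', B', v', h, rfl⟩ | ⟨A, w', h, rfl⟩
            · left
              simp only at hB
              subst hB
              refine ⟨u ++ u', B', v' ++ v, by rw [h2]; simp, ?_⟩
              intro w hw
              have := hg _ (Gen.step h hw)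
              simpa using this
            · right
              simp only at hB
              subst hB
              exact ⟨u ++ w' ++ v, by rw [h2]; simp, hg _ (Gen.base h)⟩
          · have : (Symbol.nonterminal r.input : Symbol T N) ∈ w.map Symbol.terminal := by
              rw [h1]; simp
            simp at this
      rcases key _ h with ⟨u, B, v, h1, _⟩ | ⟨w', h1, h2⟩
      · have : (Symbol.nonterminal B : Symbol T N) ∈ w.map Symbol.terminal := by
          rw [h1]; simp
        simp at this
      · have : w = w' := List.map_injective_iff.2 (fun a b h => by simpa using h) h1
        rw [this]; exact h2
    · intro h
      have key : ∀ A w, Gen R F A w →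
          g.Derives [Symbol.nonterminal A] (w.map Symbol.terminal) := by
        intro A w h
        induction h with
        | @base A w hf =>
          refine Relation.ReflTransGen.single ⟨⟨A, w.map Symbol.terminal⟩, (hr _).2 (Or.inr ⟨_, _, hf, rfl⟩), ?_⟩
          rw [ContextFreeRule.rewrites_iff]
          exact ⟨[], [], by simp, by simp⟩
        | @step A B u v w hR' _ ih =>
          have h1 : g.Produces [Symbol.nonterminal A] (u.map Symbol.terminal ++
              [Symbol.nonterminal B] ++ v.map Symbol.terminal) := by
            refine ⟨_, (hr _).2 (Or.inl ⟨_, _, _, _, hR', rfl⟩), ?_⟩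
            rw [ContextFreeRule.rewrites_iff]
            exact ⟨[], [], by simp, by simp⟩
          refine Relation.ReflTransGen.head h1 ?_
          have := (ih.append_left (u.map Symbol.terminal)).append_right (v.map Symbol.terminal)
          simpa using this
      exact key _ _ h

theorem isLinear_finite {T : Type} {L : Set (List T)} (hL : L.Finite) : IsLinearLang L := by
  have h := isLinear_gen (N := Unit) (T := T) (fun _ _ _ _ => False) (fun _ w => w ∈ L)
    (by simp) (by
      refine (hL.image (fun w => ((), w))).subset ?_
      rintro ⟨⟨⟩, w⟩ hw
      exact ⟨w, hw, rfl⟩) ()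
  convert h using 1
  ext w
  constructor
  · intro hw; exact Gen.base hw
  · intro hw
    cases hw with
    | base h => exact h
    | step h _ => exact h.elim

/-- pattern matching; `none` is a wildcard for arbitrary words. -/
def pm {V : Type} : List (Option V) → List V → Prop
  | [], w => w = []
  | some a :: p, w => ∃ w', w = a :: w' ∧ pm p w'
  | none :: p, w => ∃ s t, w = s ++ t ∧ pm p t

theorem pm_append {V : Type} (p q : List (Option V)) (w : List V) :
    pm (p ++ q) w ↔ ∃ s t, w = s ++ t ∧ pm p s ∧ pm q t := by
  induction p generalizing w with
  | nil => simp [pm]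
  | cons x p ih =>
    cases x with
    | none =>
      simp only [List.cons_append, pm, ih]
      constructor
      · rintro ⟨s, _, rfl, s', t', rfl, h1, h2⟩
        exact ⟨s ++ s', t', by simp, ⟨s, s', rfl, h1⟩, h2⟩
      · rintro ⟨_, t, rfl, ⟨s, t', rfl, h1⟩, h2⟩
        exact ⟨s, t' ++ t, by simp, t', t, rfl, h1, h2⟩
    | some a =>
      simp only [List.cons_append, pm, ih]
      constructor
      · rintro ⟨_, rfl, s', t', rfl, h1, h2⟩
        exact ⟨a :: s', t', by simp, ⟨s', rfl, h1⟩, h2⟩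
      · rintro ⟨_, t, rfl, ⟨t', rfl, h1⟩, h2⟩
        exact ⟨t' ++ t, by simp, t', t, rfl, h1, h2⟩

theorem pm_word {V : Type} (u w : List V) : pm (u.map some) w ↔ w = u := by
  induction u generalizing w with
  | nil => simp [pm]
  | cons a u ih => simp [pm, ih]

theorem pm_none {V : Type} (w : List V) : pm [none] w ↔ True := by
  simp [pm]

theorem pm_some {V : Type} (a : V) (w : List V) : pm [some a] w ↔ w = [a] := by
  simp [pm]

theorem pm_left {V : Type} (p : List (Option V)) (a : V) (w : List V) (h : pm p (a :: w)) :
    ∃ p', p' <:+: p ∧ pm p' w ∧ ∀ w', pm p' w' → pm p (a :: w') := by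
  induction p with
  | nil => simp [pm] at h
  | cons x p ih =>
    cases x with
    | some b =>
      obtain ⟨w', h1, h2⟩ := h
      simp at h1
      obtain ⟨rfl, rfl⟩ := h1
      exact ⟨p, (List.suffix_cons _ _).isInfix, h2, fun w' hw' => ⟨w', rfl, hw'⟩⟩
    | none =>
      obtain ⟨s, t, h1, h2⟩ := h
      cases s with
      | nil =>
        simp at h1; subst h1
        obtain ⟨p', h3, h4, h5⟩ := ih h2
        exact ⟨p', h3.trans (List.suffix_cons _ _).isInfix, h4, fun w' hw' => ⟨[], _, rfl, h5 w' hw'⟩⟩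
      | cons b s =>
        simp at h1
        obtain ⟨rfl, rfl⟩ := h1
        refine ⟨none :: p, List.infix_refl _, ⟨s, t, rfl, h2⟩, ?_⟩
        rintro _ ⟨s', t', rfl, h'⟩
        exact ⟨a :: s', t', rfl, h'⟩

theorem pm_reverse {V : Type} (p : List (Option V)) (w : List V) :
    pm p.reverse w.reverse ↔ pm p w := by
  induction p generalizing w with
  | nil => simp [pm]
  | cons x p ih =>
    rw [List.reverse_cons, pm_append]
    cases x with
    | none =>
      rw [pm]; simp only [pm_none]
      constructor
      · rintro ⟨s, t, h1, h2, -⟩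
        refine ⟨t.reverse, s.reverse, by rw [← List.reverse_append, ← h1]; simp, ?_⟩
        rw [← ih]; simpa using h2
      · rintro ⟨s, t, rfl, h⟩
        exact ⟨t.reverse, s.reverse, by simp, (ih t).2 h, trivial⟩
    | some a =>
      rw [pm]; simp only [pm_some]
      constructor
      · rintro ⟨s, t, h1, h2, rfl⟩
        refine ⟨s.reverse, ?_, ?_⟩
        · rw [← List.reverse_reverse w, h1]; simp
        · rw [← ih]; simpa using h2
      · rintro ⟨w', rfl, h⟩
        exact ⟨w'.reverse, [a], by simp, (ih w').2 h, rfl⟩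

theorem pm_right {V : Type} (p : List (Option V)) (a : V) (w : List V) (h : pm p (w ++ [a])) :
    ∃ p', p' <:+: p ∧ pm p' w ∧ ∀ w', pm p' w' → pm p (w' ++ [a]) := by
  rw [← pm_reverse] at h
  simp only [List.reverse_append, List.reverse_cons, List.reverse_nil, List.nil_append,
    List.singleton_append] at h
  obtain ⟨p', h1, h2, h3⟩ := pm_left _ _ _ h
  refine ⟨p'.reverse, ?_, ?_, ?_⟩
  · rw [← List.reverse_infix]; simpa using h1
  · rw [← pm_reverse]; simpa using h2
  · intro w' hw'
    rw [← pm_reverse]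
    simp only [List.reverse_append, List.reverse_cons, List.reverse_nil, List.nil_append,
      List.singleton_append]
    apply h3
    rw [← pm_reverse]; simpa using hw'

theorem pm_lefts {V : Type} (u : List V) (p : List (Option V)) (w : List V) (h : pm p (u ++ w)) :
    ∃ p', p' <:+: p ∧ pm p' w ∧ ∀ w', pm p' w' → pm p (u ++ w') := by
  induction u generalizing p with
  | nil => exact ⟨p, List.infix_refl _, h, fun _ h => h⟩
  | cons a u ih =>
    obtain ⟨p', h1, h2, h3⟩ := pm_left _ _ _ h
    obtain ⟨q, h4, h5, h6⟩ := ih _ h2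
    exact ⟨q, h4.trans h1, h5, fun w' hw' => h3 _ (h6 _ hw')⟩

theorem pm_rights {V : Type} (v : List V) (p : List (Option V)) (w : List V) (h : pm p (w ++ v)) :
    ∃ p', p' <:+: p ∧ pm p' w ∧ ∀ w', pm p' w' → pm p (w' ++ v) := by
  induction v using List.reverseRecOn generalizing p with
  | nil => exact ⟨p, List.infix_refl _, by simpa using h, fun _ h => by simpa using h⟩
  | append_singleton v a ih =>
    rw [← List.append_assoc] at h
    obtain ⟨p', h1, h2, h3⟩ := pm_right _ _ _ h
    obtain ⟨q, h4, h5, h6⟩ := ih _ h2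
    exact ⟨q, h4.trans h1, h5, fun w' hw' => by
      rw [← List.append_assoc]; exact h3 _ (h6 _ hw')⟩

theorem pm_both {V : Type} (u v : List V) (p : List (Option V)) (w : List V)
    (h : pm p (u ++ w ++ v)) :
    ∃ p', p' <:+: p ∧ pm p' w ∧ ∀ w', pm p' w' → pm p (u ++ w' ++ v) := by
  obtain ⟨p', h1, h2, h3⟩ := pm_rights _ _ _ h
  obtain ⟨q, h4, h5, h6⟩ := pm_lefts _ _ _ h2
  exact ⟨q, h4.trans h1, h5, fun w' hw' => h3 _ (h6 _ hw')⟩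

theorem mem_substL {α β : Type} (f : α → Set (List β)) (L : Set (List α)) (x : List β) :
    x ∈ substL f L ↔ ∃ w ∈ L, x ∈ substW f w := by
  simp [substL]

theorem substW_append {α β : Type} (f : α → Set (List β)) (u v : List α) (x : List β) :
    x ∈ substW f (u ++ v) ↔ ∃ s t, x = s ++ t ∧ s ∈ substW f u ∧ t ∈ substW f v := by
  induction u generalizing x with
  | nil => simp [substW]
  | cons a u ih =>
    simp only [List.cons_append, substW, Set.mem_image2, ih]
    constructor
    · rintro ⟨y, hy, _, ⟨s, t, rfl, h1, h2⟩, rfl⟩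
      exact ⟨y ++ s, t, by simp, ⟨y, hy, s, h1, rfl⟩, h2⟩
    · rintro ⟨_, t, rfl, ⟨y, hy, s, h1, rfl⟩, h2⟩
      exact ⟨y, hy, s ++ t, ⟨s, t, rfl, h1, h2⟩, by simp⟩

/-- letter-to-letter substitution given by a relation -/
def relS {α β : Type} (R : α → β → Prop) (a : α) : Set (List β) := {l | ∃ c, R a c ∧ l = [c]}

theorem mem_substW_relS {α β : Type} (R : α → β → Prop) (w : List α) (x : List β) :
    x ∈ substW (relS R) w ↔ List.Forall₂ R w x := by
  induction w generalizing x with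
  | nil => simp [substW]
  | cons a w ih =>
    simp only [substW, Set.mem_image2, ih, relS]
    constructor
    · rintro ⟨_, ⟨c, h, rfl⟩, t, ht, rfl⟩
      exact List.Forall₂.cons h ht
    · intro h
      cases h with
      | cons h1 h2 => exact ⟨_, ⟨_, h1, rfl⟩, _, h2, rfl⟩

theorem hash_unique {V : Type} {a b l : List (Option V)} {y : List V}
    (h1 : b ++ a = none :: l) (h2 : a ++ b = none :: y.map some) : l = y.map some := by
  cases b with
  | nil =>
    simp at h1 h2
    rw [h1] at h2
    simpa using h2
  | cons c b =>
    simp at h1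
    obtain ⟨rfl, h1⟩ := h1
    cases a with
    | nil =>
      simp at h1 h2
      rw [← h1, h2]
    | cons d a =>
      simp at h2
      have : (none : Option V) ∈ y.map some := by rw [← h2.2]; simp
      simp at this

theorem hash_rot {V : Type} {l : List (Option V)} {y : List V}
    (h : (none :: l) ~r (none :: y.map some)) : l = y.map some := by
  obtain ⟨n, hn, hk'⟩ := List.isRotated_iff_mod.1 h
  rw [List.rotate_eq_drop_append_take hn] at hk'
  exact hash_unique (List.take_append_drop n _) hk'

end helpers

section closure

structure Cl (𝓛 : ∀ α : Type, Set (Set (List α))) : Prop where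
  lin : ∀ (α : Type) (L : Set (List α)), IsLinearLang L → L ∈ 𝓛 α
  cp : ∀ (α : Type) (L : Set (List α)), L ∈ 𝓛 α → cp L ∈ 𝓛 α
  ld : ∀ (α : Type) (L : Set (List α)) (w : List α), L ∈ 𝓛 α → leftDeriv w L ∈ 𝓛 α
  sub : ∀ (α β : Type) (f : α → Set (List β)) (L : Set (List α)),
      L ∈ 𝓛 α → (∀ a : α, f a ∈ 𝓛 β) → substL f L ∈ 𝓛 β

theorem Cl.fin {𝓛 : ∀ α : Type, Set (Set (List α))} (h : Cl 𝓛) {α : Type} {L : Set (List α)}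
    (hL : L.Finite) : L ∈ 𝓛 α := h.lin _ _ (isLinear_finite hL)

theorem Cl.concat {𝓛 : ∀ α : Type, Set (Set (List α))} (h : Cl 𝓛) {α : Type}
    {L M : Set (List α)} (hL : L ∈ 𝓛 α) (hM : M ∈ 𝓛 α) :
    {w | ∃ s t, w = s ++ t ∧ s ∈ L ∧ t ∈ M} ∈ 𝓛 α := by
  have := h.sub Bool α (fun b => if b then M else L) {[false, true]} (h.fin (Set.finite_singleton _))
    (by intro a; cases a <;> simp [hL, hM])
  convert this using 1
  ext w
  simp only [mem_substL, Set.mem_singleton_iff, exists_eq_left, substW, Set.mem_image2,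
    Set.mem_ofPred_eq]
  constructor
  · rintro ⟨s, t, rfl, h1, h2⟩
    exact ⟨s, h1, t, ⟨t, h2, by simp⟩, rfl⟩
  · rintro ⟨s, h1, _, ⟨t, h2, _, rfl, rfl⟩, rfl⟩
    exact ⟨s, t, by simp, h1, h2⟩

theorem Cl.rel {𝓛 : ∀ α : Type, Set (Set (List α))} (h : Cl 𝓛) {α β : Type}
    {L : Set (List α)} (hL : L ∈ 𝓛 α) (R : α → β → Prop) (hR : ∀ a, {c | R a c}.Finite) :
    {x | ∃ w ∈ L, List.Forall₂ R w x} ∈ 𝓛 β := by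
  have := h.sub α β (relS R) L hL (fun a => h.fin (((hR a).image (fun c => [c])).subset (by
    rintro _ ⟨c, hc, rfl⟩; exact ⟨c, hc, rfl⟩)))
  convert this using 1
  ext x
  simp only [mem_substL, mem_substW_relS, Set.mem_ofPred_eq]

theorem f2_map {α β γ : Type} {R : β → γ → Prop} (f : α → β) (g : α → γ)
    (h : ∀ a, R (f a) (g a)) (w : List α) : List.Forall₂ R (w.map f) (w.map g) := by
  induction w with
  | nil => exact List.Forall₂.nil
  | cons a w ih => exact List.Forall₂.cons (h a) ih

theorem f2_map_eq {α β γ : Type} {R : α → β → Prop} (f : α → γ) (g : β → γ)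
    (h : ∀ a b, R a b → f a = g b) {w : List α} {x : List β} (hw : List.Forall₂ R w x) :
    w.map f = x.map g := by
  induction hw with
  | nil => rfl
  | cons h1 _ ih => simp [ih, h _ _ h1]

theorem Cl.factor {𝓛 : ∀ α : Type, Set (Set (List α))} (h : Cl 𝓛) {V : Type}
    {L : Set (List V)} (hL : L ∈ 𝓛 V) (u : List V) :
    {w | w ∈ L ∧ ∃ t v, w = t ++ u ++ v} ∈ 𝓛 V := by
  let P : V → Option (V × Bool) := fun a => some (a, false)
  let M : V → Option (V × Bool) := fun a => some (a, true)
  let R1 : V → Option (V × Bool) → Prop := fun a c => c = P a ∨ c = M a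
  let R5 : Option (V × Bool) → Option V → Prop :=
    fun c d => (c = none ∧ d = none) ∨ ∃ a, c = P a ∧ d = some a
  let R9 : Option V → V → Prop := fun d a => d = some a
  have h1 := h.rel hL R1 (fun a => by
    refine (Set.toFinite ({P a, M a} : Set _)).subset ?_
    intro c hc; exact hc)
  have h2 := h.concat h1 (h.fin (Set.finite_singleton ([none] : List (Option (V × Bool)))))
  have h4 := h.ld _ _ (u.map M) (h.cp _ _ h2)
  have h5 := h.rel h4 R5 (fun c => by
    refine (Set.finite_singleton (c.map Prod.fst)).subset ?_
    rintro d (⟨rfl, rfl⟩ | ⟨a, rfl, rfl⟩) <;> rfl)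
  have h6 := h.concat h5 (h.fin (Set.finite_singleton (u.map some)))
  have h8 := h.ld _ _ [none] (h.cp _ _ h6)
  have h9 := h.rel h8 R9 (fun d => by
    cases d with
    | none => simp [R9]
    | some a =>
      refine (Set.finite_singleton a).subset ?_
      intro c hc; simpa [R9, eq_comm] using hc)
  convert h9 using 1
  ext x
  constructor
  · rintro ⟨hx, t, v, rfl⟩
    refine ⟨(t ++ u ++ v).map some, ?_, ?_⟩
    · refine ⟨v.map some, none :: (t.map some ++ u.map some), ?_, by simp⟩
      refine ⟨v.map some ++ (none :: t.map some), u.map some, by simp, ?_, rfl⟩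
      refine ⟨v.map P ++ (none :: t.map P), ?_, ?_⟩
      · refine ⟨t.map P, u.map M ++ v.map P ++ [none], ?_, by simp⟩
        refine ⟨t.map P ++ u.map M ++ v.map P, [none], by simp, ?_, rfl⟩
        refine ⟨_, hx, ?_⟩
        have e1 : ∀ l : List V, List.Forall₂ R1 l (l.map P) := fun l => by
          simpa using f2_map (R := R1) id P (fun a => Or.inl rfl) l
        have e2 : ∀ l : List V, List.Forall₂ R1 l (l.map M) := fun l => by
          simpa using f2_map (R := R1) id M (fun a => Or.inr rfl) l
        exact List.rel_append (List.rel_append (e1 t) (e2 u)) (e1 v)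
      · have e : ∀ l : List V, List.Forall₂ R5 (l.map P) (l.map some) := fun l =>
          f2_map (R := R5) P some (fun a => Or.inr ⟨a, rfl, rfl⟩) l
        exact List.rel_append (e v) (List.Forall₂.cons (Or.inl ⟨rfl, rfl⟩) (e t))
    · simpa using f2_map (R := R9) some id (fun a => rfl) (t ++ u ++ v)
  · rintro ⟨d, ⟨a1, b1, ⟨y, _, e6, ⟨y', ⟨a2, b2, ⟨z, _, e2, ⟨w, hw, hwz⟩, rfl⟩, e4⟩, hy⟩, rfl⟩, e8⟩, hd⟩
    have hd' : d = x.map some := by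
      have := f2_map_eq (R := R9) id some (fun a b h => h) hd
      simpa using this
    have hy' : y'.map (Option.map Prod.fst) = y := by
      have := f2_map_eq (R := R5) (Option.map Prod.fst) id (by
        rintro a b (⟨rfl, rfl⟩ | ⟨a, rfl, rfl⟩) <;> rfl) hy
      simpa using this
    have hz' : w.map some = z.map (Option.map Prod.fst) :=
      f2_map_eq (R := R1) some (Option.map Prod.fst) (by
        rintro a b (rfl | rfl) <;> rfl) hwz
    have r1 : (u.map M ++ y') ~r (z ++ [none]) := by
      rw [e4, ← e2]; exact List.isRotated_append
    have r2 : (u.map some ++ y) ~r (none :: w.map some) := by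
      have := r1.map (Option.map Prod.fst)
      rw [List.map_append, List.map_append, hy', ← hz', List.map_map] at this
      exact this.trans (by simpa using List.isRotated_append (l := w.map some) (l' := [none]))
    have r3 : (none :: x.map some) ~r (y ++ u.map some) := by
      rw [← e6, ← hd']
      change ([none] ++ d) ~r _
      rw [e8]; exact List.isRotated_append
    have hn : none ∈ y := by
      have : none ∈ u.map some ++ y := r2.mem_iff.2 (by simp)
      simpa using this
    obtain ⟨a, b, rfl⟩ := List.append_of_mem hn
    have q1 : b ++ u.map some ++ a = w.map some := by
      apply hash_rot
      refine List.IsRotated.trans ?_ r2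
      have := List.isRotated_append (l := none :: b) (l' := u.map some ++ a)
      simpa using this
    have q2 : x.map some = w.map some := by
      apply hash_rot
      refine r3.trans ?_
      rw [← q1]
      have := List.isRotated_append (l := a) (l' := none :: b ++ u.map some)
      simpa using this
    have q3 : x = w := List.map_injective_iff.2 (Option.some_injective _) q2
    subst q3
    refine ⟨hw, ?_⟩
    obtain ⟨l1, v, rfl, h3, rfl⟩ := List.map_eq_append_iff.1 q1.symm
    obtain ⟨t, u', rfl, rfl, h7⟩ := List.map_eq_append_iff.1 h3
    have : u' = u := List.map_injective_iff.2 (Option.some_injective _) h7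
    subst this
    exact ⟨t, v, rfl⟩

theorem Cl.consL {𝓛 : ∀ α : Type, Set (Set (List α))} (h : Cl 𝓛) {V : Type} (a : V)
    (p : List (Option V)) (hp : ∀ L ∈ 𝓛 V, {w | w ∈ L ∧ pm p w} ∈ 𝓛 V) :
    ∀ L ∈ 𝓛 V, {w | w ∈ L ∧ pm (some a :: p) w} ∈ 𝓛 V := by
  intro L hL
  have h1 := h.concat (h.fin (Set.finite_singleton [a])) (hp _ (h.ld _ _ [a] hL))
  convert h1 using 1
  ext w
  constructor
  · rintro ⟨hw, w', rfl, hw'⟩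
    exact ⟨[a], w', rfl, rfl, hw, hw'⟩
  · rintro ⟨_, w', rfl, rfl, hw, hw'⟩
    exact ⟨hw, w', rfl, hw'⟩

/-- right derivative by a letter -/
theorem Cl.rd {𝓛 : ∀ α : Type, Set (Set (List α))} (h : Cl 𝓛) {V : Type} (a : V)
    {L : Set (List V)} (hL : L ∈ 𝓛 V) : {w | w ++ [a] ∈ L} ∈ 𝓛 V := by
  have h1 := h.rel hL (fun a c => c = some a) (fun a => Set.finite_singleton (some a))
  have h2 := h.concat h1 (h.fin (Set.finite_singleton ([none] : List (Option V))))
  have h3 := h.ld _ _ [some a, none] (h.cp _ _ h2)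
  have h4 := h.rel h3 (fun (d : Option V) a => d = some a) (fun d => by
    cases d with
    | none => simp
    | some a =>
      refine (Set.finite_singleton a).subset ?_
      intro c hc; simpa [eq_comm] using hc)
  convert h4 using 1
  ext x
  constructor
  · intro hx
    refine ⟨x.map some, ⟨x.map some, [some a, none], ?_, rfl⟩, ?_⟩
    · refine ⟨(x ++ [a]).map some, [none], by simp, ⟨_, hx, ?_⟩, rfl⟩
      simpa using f2_map (R := fun a c => c = some a) id some (fun a => rfl) (x ++ [a])
    · simpa using f2_map (R := fun (d : Option V) a => d = some a) some id (fun a => rfl) x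
  · rintro ⟨d, ⟨a1, b1, ⟨y, _, e6, ⟨w, hw, hwy⟩, rfl⟩, e8⟩, hd⟩
    have hd' : d = x.map some := by
      have := f2_map_eq (R := fun (d : Option V) a => d = some a) id some (fun a b h => h) hd
      simpa using this
    have hy' : y = w.map some := by
      have := f2_map_eq (R := fun a (c : Option V) => c = some a) some id (fun a b h => h.symm) hwy
      simpa using this.symm
    have r : (none :: (x ++ [a]).map some) ~r (none :: w.map some) := by
      have r1 : (none :: (x ++ [a]).map some) ~r ([some a, none] ++ d) := by
        rw [hd']
        have := List.isRotated_append (l := none :: x.map some) (l' := [some a])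
        simpa using this
      have r2 : ([some a, none] ++ d) ~r (w.map some ++ [none]) := by
        rw [e8, ← hy', ← e6]; exact List.isRotated_append
      exact (r1.trans r2).trans
        (by simpa using List.isRotated_append (l := w.map some) (l' := [none]))
    have := hash_rot r
    have : x ++ [a] = w := List.map_injective_iff.2 (Option.some_injective _) this
    change x ++ [a] ∈ L
    rw [this]; exact hw

theorem Cl.consR {𝓛 : ∀ α : Type, Set (Set (List α))} (h : Cl 𝓛) {V : Type} (a : V)
    (p : List (Option V)) (hp : ∀ L ∈ 𝓛 V, {w | w ∈ L ∧ pm p w} ∈ 𝓛 V) :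
    ∀ L ∈ 𝓛 V, {w | w ∈ L ∧ pm (p ++ [some a]) w} ∈ 𝓛 V := by
  intro L hL
  have h1 := h.concat (hp _ (h.rd a hL)) (h.fin (Set.finite_singleton [a]))
  convert h1 using 1
  ext w
  simp only [Set.mem_ofPred_eq, pm_append, pm_some]
  constructor
  · rintro ⟨hw, w', _, rfl, hw', rfl⟩
    exact ⟨w', [a], rfl, ⟨hw, hw'⟩, rfl⟩
  · rintro ⟨w', _, rfl, ⟨hw, hw'⟩, rfl⟩
    exact ⟨hw, w', _, rfl, hw', rfl⟩

theorem exists_word {V : Type} (p : List (Option V)) (hp : p.countP Option.isNone = 0) :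
    ∃ u : List V, p = u.map some := by
  induction p with
  | nil => exact ⟨[], rfl⟩
  | cons x p ih =>
    cases x with
    | none => simp at hp
    | some a =>
      obtain ⟨u, rfl⟩ := ih (by simpa using hp)
      exact ⟨a :: u, rfl⟩

theorem Cl.pat {𝓛 : ∀ α : Type, Set (Set (List α))} (h : Cl 𝓛) {V : Type} (n : ℕ) :
    ∀ (p : List (Option V)), p.length ≤ n → p.countP Option.isNone ≤ 2 →
      ∀ L ∈ 𝓛 V, {w | w ∈ L ∧ pm p w} ∈ 𝓛 V := by
  induction n with
  | zero =>
    intro p hn _ L _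
    have : p = [] := List.length_eq_zero_iff.1 (by omega)
    subst this
    exact h.fin ((Set.finite_singleton ([] : List V)).subset (fun w hw => hw.2))
  | succ n ih =>
    intro p hn hc
    cases p with
    | nil => exact ih [] (by simp) hc
    | cons x p =>
      cases x with
      | some a => exact h.consL a p (ih p (by simpa using hn) (by simpa using hc))
      | none =>
        rcases List.eq_nil_or_concat' p with rfl | ⟨q, y, rfl⟩
        · intro L hL
          convert hL using 1
          ext w
          simp [pm_none]
        · cases y with
          | some a =>
            exact h.consR a (none :: q) (ih _ (by simp at hn ⊢; omega) (by simpa using hc))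
          | none =>
            obtain ⟨u, rfl⟩ := exists_word q (by simp at hc ⊢; simpa using hc)
            intro L hL
            convert h.factor hL u using 1
            ext w
            simp only [Set.mem_ofPred_eq, pm, pm_append, pm_word]
            refine and_congr_right fun _ => ⟨?_, ?_⟩
            · rintro ⟨s, t, rfl, _, t, rfl, rfl, -⟩
              exact ⟨s, t, by simp⟩
            · rintro ⟨s, t, rfl⟩
              exact ⟨s, u ++ t, by simp, u, t, rfl, rfl, t, [], by simp, rfl⟩

end closure

section main

/-- facts: patterns of bounded length with at most two wildcards -/
def Fact (V : Type) (n : ℕ) : Type :=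
  {p : List (Option V) // p.length ≤ n ∧ p.countP Option.isNone ≤ 2}

instance {V : Type} [Fintype V] (n : ℕ) : Finite (Fact V n) :=
  ((List.finite_length_le (Option V) n).subset (fun p (hp : p.length ≤ n ∧ p.countP Option.isNone ≤ 2) =>
    hp.1)).to_subtype

def sat {V : Type} (n : ℕ) (w : List V) : Set (Fact V n) := {q | pm q.1 w}

def upd {V : Type} {n : ℕ} (S : Set (Fact V n)) (u v : List V) : Set (Fact V n) :=
  {q | ∃ q' ∈ S, ∀ w, pm q'.1 w → pm q.1 (u ++ w ++ v)}

theorem sat_upd {V : Type} (n : ℕ) (w u v : List V) :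
    sat n (u ++ w ++ v) ⊆ upd (sat n w) u v := by
  rintro ⟨p, hp⟩ hq
  obtain ⟨p', h1, h2, h3⟩ := pm_both u v p w hq
  exact ⟨⟨p', h1.length_le.trans hp.1, (h1.sublist.countP_le).trans hp.2⟩, h2, h3⟩

theorem upd_sat {V : Type} {n : ℕ} {S : Set (Fact V n)} {w u v : List V} (h : S ⊆ sat n w) :
    upd S u v ⊆ sat n (u ++ w ++ v) := by
  rintro q ⟨q', h1, h2⟩
  exact h2 w (h h1)

def patR (γ α α' : List V) : List (Option V) :=
  none :: ((γ ++ α).map some ++ none :: α'.map some)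

def patL (γ α α' : List V) : List (Option V) :=
  α.map some ++ none :: ((α' ++ γ).map some ++ [none])

theorem pm_patR (γ α α' w : List V) :
    pm (patR γ α α') w ↔ ∃ δ β, w = δ ++ γ ++ α ++ β ++ α' := by
  simp only [patR, pm, pm_append, pm_word]
  constructor
  · rintro ⟨s, _, rfl, _, _, rfl, rfl, b, _, rfl, rfl⟩
    exact ⟨s, b, by simp⟩
  · rintro ⟨s, b, rfl⟩
    exact ⟨s, γ ++ α ++ (b ++ α'), by simp, γ ++ α, b ++ α', by simp, rfl, b, α', rfl, rfl⟩

theorem pm_patL (γ α α' w : List V) :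
    pm (patL γ α α') w ↔ ∃ β δ, w = α ++ β ++ α' ++ γ ++ δ := by
  simp only [patL, pm, pm_append, pm_word]
  constructor
  · rintro ⟨_, _, rfl, rfl, b, _, rfl, _, d, rfl, rfl, -⟩
    exact ⟨b, d, by simp⟩
  · rintro ⟨b, d, rfl⟩
    exact ⟨α, b ++ (α' ++ γ ++ d), by simp, rfl, b, _, rfl, α' ++ γ, d, rfl, rfl, d, [], by simp, rfl⟩

theorem countP_map_some (l : List V) : (l.map some).countP Option.isNone = 0 := by
  rw [List.countP_eq_zero]; simp

def en (bar : V → V) (m k n : ℕ) (S : Set (Fact V n)) (u v : List V) : Prop :=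
  ∃ γ α : List V, α.length = k ∧ γ.length ≤ m ∧ ∃ q ∈ S,
    ((u = [] ∧ v = rc bar γ ∧ q.1 = patR γ α (rc bar α)) ∨
     (v = [] ∧ u = rc bar γ ∧ q.1 = patL γ α (rc bar α)))

theorem en_HI (bar : V → V) (m k n : ℕ) {S : Set (Fact V n)} {u v w : List V}
    (hS : S ⊆ sat n w) (h : en bar m k n S u v) : u ++ w ++ v ∈ HI bar m k w := by
  obtain ⟨γ, α, hα, hγ, q, hq, ⟨rfl, rfl, e⟩ | ⟨rfl, rfl, e⟩⟩ := h
  · left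
    have := hS hq
    change pm _ _ at this
    rw [e, pm_patR] at this
    obtain ⟨δ, β, hw⟩ := this
    rw [rHI, if_pos ⟨δ, γ, α, β, hw, hα, hγ⟩]
    exact ⟨δ, γ, α, β, hw, hα, hγ, by simp⟩
  · right
    have := hS hq
    change pm _ _ at this
    rw [e, pm_patL] at this
    obtain ⟨β, δ, hw⟩ := this
    rw [lHI, if_pos ⟨α, β, γ, δ, hw, hα, hγ⟩]
    exact ⟨α, β, γ, δ, hw, hα, hγ, by simp⟩

theorem HI_en (bar : V → V) (m k : ℕ) {w w' : List V} (h : w' ∈ HI bar m k w) :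
    w' = w ∨ ∃ u v, w' = u ++ w ++ v ∧ en bar m k (m + 2 * k + 2) (sat (m + 2 * k + 2) w) u v := by
  rcases h with h | h
  · rw [rHI] at h
    split_ifs at h
    · obtain ⟨δ, γ, α, β, hw, hα, hγ, rfl⟩ := h
      right
      refine ⟨[], rc bar γ, by simp, γ, α, hα, hγ, ⟨patR γ α (rc bar α), ?_, ?_⟩, ?_, Or.inl ⟨rfl, rfl, rfl⟩⟩
      · simp [patR, rc]; omega
      · simp only [patR, List.countP_cons, List.countP_append, countP_map_some]; simp
      · change pm _ _
        rw [pm_patR]; exact ⟨δ, β, hw⟩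
    · exact Or.inl h
  · rw [lHI] at h
    split_ifs at h
    · obtain ⟨α, β, γ, δ, hw, hα, hγ, rfl⟩ := h
      right
      refine ⟨rc bar γ, [], by simp, γ, α, hα, hγ, ⟨patL γ α (rc bar α), ?_, ?_⟩, ?_, Or.inr ⟨rfl, rfl, rfl⟩⟩
      · simp [patL, rc]; omega
      · simp only [patL, List.countP_cons, List.countP_append, countP_map_some]; simp
      · change pm _ _
        rw [pm_patL]; exact ⟨β, δ, hw⟩
    · exact Or.inl h

def ruleR (bar : V → V) (m k n : ℕ) (A : Set (Fact V n)) (x : List (V ⊕ Set (Fact V n)))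
    (B : Set (Fact V n)) (y : List (V ⊕ Set (Fact V n))) : Prop :=
  ∃ u v : List V, x = u.map Sum.inl ∧ y = v.map Sum.inl ∧ en bar m k n B u v ∧ A ⊆ upd B u v

def ruleF (n : ℕ) (A : Set (Fact V n)) (x : List (V ⊕ Set (Fact V n))) : Prop :=
  ∃ B, A ⊆ B ∧ x = [Sum.inr B]

theorem en_length {bar : V → V} {m k n : ℕ} {S : Set (Fact V n)} {u v : List V}
    (h : en bar m k n S u v) : u.length ≤ m ∧ v.length ≤ m := by
  obtain ⟨γ, α, hα, hγ, q, hq, ⟨rfl, rfl, e⟩ | ⟨rfl, rfl, e⟩⟩ := h <;> simp [rc, hγ]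

theorem rule_lin [Fintype V] (bar : V → V) (m k n : ℕ) :
    IsLinearLang {w | Gen (ruleR bar m k n) (ruleF n) (∅ : Set (Fact V n)) w} := by
  apply isLinear_gen
  · have hf := List.finite_length_le (V ⊕ Set (Fact V n)) m
    refine ((Set.finite_univ (α := Set (Fact V n))).prod (hf.prod
      ((Set.finite_univ (α := Set (Fact V n))).prod hf))).subset ?_
    rintro ⟨A, x, B, y⟩ ⟨u, v, h1, h2, h3, h4⟩
    simp only at h1 h2 h3
    have := en_length h3
    subst h1 h2
    simpa using this
  · refine ((Set.finite_univ (α := Set (Fact V n))).prod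
      (List.finite_length_le (V ⊕ Set (Fact V n)) 1)).subset ?_
    rintro ⟨A, x⟩ ⟨B, h1, h2⟩
    simp only at h2
    subst h2
    simp

theorem HIn_trans (bar : V → V) (m k : ℕ) {w x y : List V} (h : x ∈ HIstar bar m k w)
    (h2 : y ∈ HI bar m k x) : y ∈ HIstar bar m k w := by
  simp only [HIstar, Set.mem_iUnion] at h ⊢
  obtain ⟨i, hi⟩ := h
  refine ⟨i + 1, ?_⟩
  simp only [HIn, Set.mem_iUnion]
  exact ⟨x, hi, h2⟩

theorem gen_sound (bar : V → V) (m k n : ℕ) {A : Set (Fact V n)} {x : List (V ⊕ Set (Fact V n))}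
    (h : Gen (ruleR bar m k n) (ruleF n) A x) :
    ∃ u B v, x = u.map Sum.inl ++ [Sum.inr B] ++ v.map Sum.inl ∧
      ∀ w, B ⊆ sat n w → u ++ w ++ v ∈ HIstar bar m k w ∧ A ⊆ sat n (u ++ w ++ v) := by
  induction h with
  | base h =>
    obtain ⟨B, h1, rfl⟩ := h
    refine ⟨[], B, [], by simp, fun w hw => ⟨?_, ?_⟩⟩
    · simp only [HIstar, Set.mem_iUnion]
      exact ⟨0, by simp [HIn]⟩
    · simpa using h1.trans hw
  | step h _ ih =>
    obtain ⟨u', v', rfl, rfl, h3, h4⟩ := h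
    obtain ⟨u, B, v, rfl, h⟩ := ih
    refine ⟨u' ++ u, B, v ++ v', by simp, fun w hw => ?_⟩
    obtain ⟨h5, h6⟩ := h w hw
    have e : u' ++ u ++ w ++ (v ++ v') = u' ++ (u ++ w ++ v) ++ v' := by simp
    rw [e]
    exact ⟨HIn_trans bar m k h5 (en_HI bar m k n h6 h3), h4.trans (upd_sat h6)⟩

theorem gen_complete (bar : V → V) (m k i : ℕ) {w x : List V} (h : x ∈ HIn bar m k w i) :
    ∃ u v, x = u ++ w ++ v ∧ ∀ A, A ⊆ sat (m + 2 * k + 2) x →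
      Gen (ruleR bar m k (m + 2 * k + 2)) (ruleF (m + 2 * k + 2)) A
        (u.map Sum.inl ++ [Sum.inr (sat (m + 2 * k + 2) w)] ++ v.map Sum.inl) := by
  induction i generalizing x with
  | zero =>
    simp only [HIn, Set.mem_singleton_iff] at h
    subst h
    exact ⟨[], [], by simp, fun A hA => Gen.base ⟨_, hA, by simp⟩⟩
  | succ i ih =>
    simp only [HIn, Set.mem_iUnion] at h
    obtain ⟨y, hy, hx⟩ := h
    obtain ⟨u, v, hyu, hg⟩ := ih hy
    rcases HI_en bar m k hx with rfl | ⟨u', v', rfl, he⟩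
    · exact ⟨u, v, hyu, hg⟩
    · refine ⟨u' ++ u, v ++ v', by rw [hyu]; simp, fun A hA => ?_⟩
      have := Gen.step (R := ruleR bar m k (m + 2 * k + 2)) (F := ruleF (m + 2 * k + 2)) (A := A)
        ⟨u', v', rfl, rfl, he, hA.trans (sat_upd _ _ _ _)⟩ (hg _ subset_rfl)
      simpa using this

theorem Cl.sat {𝓛 : ∀ α : Type, Set (Set (List α))} (h : Cl 𝓛) {V : Type} [Fintype V] (n : ℕ)
    {L : Set (List V)} (hL : L ∈ 𝓛 V) (S : Set (Fact V n)) :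
    {w | w ∈ L ∧ S ⊆ sat n w} ∈ 𝓛 V := by
  induction S, S.toFinite using Set.Finite.induction_on with
  | empty => simpa using hL
  | @insert q S _ _ ih =>
    have := h.pat n q.1 q.2.1 q.2.2 _ ih
    convert this using 1
    ext w
    simp only [Set.mem_ofPred_eq, Set.insert_subset_iff, and_assoc]
    exact and_congr_right fun _ => and_comm

theorem substW_inl {α β : Type} (f : α ⊕ β → Set (List α)) (hf : ∀ a, f (Sum.inl a) = {[a]})
    (u x : List α) : x ∈ substW f (u.map Sum.inl) ↔ x = u := by
  induction u generalizing x with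
  | nil => simp [substW]
  | cons a u ih =>
    simp only [List.map_cons, substW, Set.mem_image2, ih, hf, Set.mem_singleton_iff]
    simp [eq_comm]

theorem substW_mid {α β : Type} (f : α ⊕ β → Set (List α)) (hf : ∀ a, f (Sum.inl a) = {[a]})
    (u v x : List α) (b : β) :
    x ∈ substW f (u.map Sum.inl ++ [Sum.inr b] ++ v.map Sum.inl) ↔
      ∃ w ∈ f (Sum.inr b), x = u ++ w ++ v := by
  simp only [substW_append, substW_inl f hf]
  constructor
  · rintro ⟨_, _, rfl, ⟨_, s, rfl, rfl, hs⟩, rfl⟩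
    simp [substW] at hs
    exact ⟨s, hs, rfl⟩
  · rintro ⟨w, hw, rfl⟩
    exact ⟨u ++ w, v, rfl, ⟨u, w, rfl, rfl, by simpa [substW] using hw⟩, rfl⟩

end main

variable {V : Type} [Fintype V]

theorem class_closed_HIstarL (bar : V → V) (hbar : ∀ a, bar (bar a) = a) (m k : ℕ) (hm : 1 ≤ m) (hk : 1 ≤ k)
    (𝓛 : ∀ α : Type, Set (Set (List α)))
    (hlin : ∀ (α : Type) (L : Set (List α)), IsLinearLang L → L ∈ 𝓛 α)
    (hcp : ∀ (α : Type) (L : Set (List α)), L ∈ 𝓛 α → cp L ∈ 𝓛 α)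
    (hld : ∀ (α : Type) (L : Set (List α)) (w : List α), L ∈ 𝓛 α → leftDeriv w L ∈ 𝓛 α)
    (hsub : ∀ (α β : Type) (f : α → Set (List β)) (L : Set (List α)),
      L ∈ 𝓛 α → (∀ a : α, f a ∈ 𝓛 β) → substL f L ∈ 𝓛 β) :
    ∀ L ∈ 𝓛 V, HIstarL bar m k L ∈ 𝓛 V := by
  intro L hL
  have h : Cl 𝓛 := ⟨hlin, hcp, hld, hsub⟩
  let n := m + 2 * k + 2
  let f : V ⊕ Set (Fact V n) → Set (List V) := fun c => match c with
    | Sum.inl a => {[a]}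
    | Sum.inr S => {w | w ∈ L ∧ S ⊆ sat n w}
  have hf : ∀ a, f (Sum.inl a) = {[a]} := fun a => rfl
  have h1 := h.sub _ _ f _ (h.lin _ _ (rule_lin bar m k n)) (by
    rintro (a | S)
    · exact h.fin (Set.finite_singleton _)
    · exact h.sat n hL S)
  convert h1 using 1
  ext x
  rw [mem_substL]
  constructor
  · intro hx
    simp only [HIstarL, HIstar, Set.mem_iUnion] at hx
    obtain ⟨w, hw, i, hi⟩ := hx
    obtain ⟨u, v, rfl, hg⟩ := gen_complete bar m k i hi
    exact ⟨_, hg ∅ (Set.empty_subset _), (substW_mid f hf _ _ _ _).2 ⟨w, ⟨hw, subset_rfl⟩, rfl⟩⟩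
  · rintro ⟨y, hy, hx⟩
    obtain ⟨u, B, v, rfl, hg⟩ := gen_sound bar m k n hy
    rw [substW_mid f hf] at hx
    obtain ⟨w, ⟨hw, hB⟩, rfl⟩ := hx
    simp only [HIstarL, Set.mem_iUnion]
    exact ⟨w, hw, (hg w hB).1⟩

end Hairpin
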